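/- Let A(S⁷) be the commutative *-algebra obtained as the quotient of the complex polynomial algebra in eight variables z₁,z₂,z₃,z₄,z₁*,z₂*,z₃*,z₄* (with the star operation interchanging z_j and z_j* and conjugating scalars) by the ideal generated by z₁*z₁+z₂*z₂+z₃*z₃+z₄*z₄ − 1. Let SU(2) act on A(S⁷) by *-algebra automorphisms determined on generators by u ↦ u·w for w ∈ SU(2), where u is the 4×2 matrix with first column (z₁,z₂,z₃,z₄)ᵗ and second column (−z₂*, z₁*, −z₄*, z₃*)ᵗ; explicitly, w = [[w¹, −w̄²],[w², w̄¹]] sends z₁ ↦ w¹z₁ − w²z₂*, z₂ ↦ w¹z₂ + w²z₁*, z₃ ↦ w¹z₃ − w²z₄*, z₄ ↦ w¹z₄ + w²z₃*, and correspondingly on the z_j*. Then the subalgebra of SU(2)-invariant elements of A(S⁷) equals the ℂ-subalgebra generated by α := 2(z₁z₃* + z₂*z₄), β := 2(z₂z₃* − z₁*z₄), x := z₁z₁* + z₂z₂* − z₃z₃* − z₄z₄*, together with α* and β*. -/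

import Mathlib

noncomputable section

open MvPolynomial

/-- The defining relation `z₁*z₁ + z₂*z₂ + z₃*z₃ + z₄*z₄ − 1` of the seven-sphere, in the
polynomial algebra on eight variables `z_j = X (inl j)`, `z_j* = X (inr j)`. -/
def spherePoly : MvPolynomial (Fin 4 ⊕ Fin 4) ℂ :=
  (∑ j : Fin 4, X (Sum.inr j) * X (Sum.inl j)) - 1

/-- The coordinate algebra `A(S⁷)` of the seven-sphere: the quotient of the polynomial
algebra in `z₁,…,z₄, z₁*,…,z₄*` by the ideal generated by the sphere relation. -/
def SevenSphere : Type :=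
  MvPolynomial (Fin 4 ⊕ Fin 4) ℂ ⧸ Ideal.span {spherePoly}

instance : CommRing SevenSphere := Ideal.Quotient.commRing _
instance : Algebra ℂ SevenSphere := Ideal.Quotient.algebra ℂ

/-- The generator `z_{j+1}` of `A(S⁷)`. -/
def zg (j : Fin 4) : SevenSphere := Ideal.Quotient.mk _ (X (Sum.inl j))

/-- The conjugate generator `z_{j+1}*` of `A(S⁷)`. -/
def zgs (j : Fin 4) : SevenSphere := Ideal.Quotient.mk _ (X (Sum.inr j))

namespace MvPolynomial

/-- A polynomial with coefficients in a complex algebra that vanishes at all real points is zero. -/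
theorem eq_zero_of_eval_ofReal_eq_zero {ι R : Type*} [CommRing R] [Algebra ℂ R]
    (p : MvPolynomial ι R)
    (h : ∀ r : ι → ℝ, eval (fun i => algebraMap ℂ R (r i)) p = 0) : p = 0 := by
  classical
  ext m
  rw [coeff_zero, ← Module.forall_dual_apply_eq_zero_iff ℂ]
  intro φ
  let q : MvPolynomial ι ℂ := ∑ d ∈ p.support, monomial d (φ (coeff d p))
  have hq : q = 0 := by
    refine funext_set (fun _ => Set.range ((↑) : ℝ → ℂ))
      (fun _ => Set.infinite_range_of_injective Complex.ofReal_injective) ?_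
    intro x hx
    choose r hr using fun i => hx i (Set.mem_univ i)
    obtain rfl : (fun i => (r i : ℂ)) = x := _root_.funext hr
    have key := congrArg φ (h r)
    rw [eval_eq, map_sum, map_zero] at key
    rw [map_zero, ← key, map_sum]
    refine Finset.sum_congr rfl fun d _ => ?_
    simp only [← map_pow, ← map_prod]
    rw [mul_comm (coeff d p), ← Algebra.smul_def, map_smul, eval_monomial, smul_eq_mul, mul_comm]
    rfl
  have hm := congrArg (coeff m) hq
  simp only [q, coeff_sum, coeff_monomial, Finset.sum_ite_eq', coeff_zero] at hm
  by_cases hmem : m ∈ p.support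
  · simpa [hmem] using hm
  · rw [notMem_support_iff.mp hmem, map_zero]

theorem IsHomogeneous.aeval_mul {ι K R : Type*} [CommRing K] [CommRing R] [Algebra K R]
    {F : MvPolynomial ι K} {n : ℕ} (hF : F.IsHomogeneous n) (c : R) (v : ι → R) :
    MvPolynomial.aeval (fun i => c * v i) F = c ^ n * MvPolynomial.aeval v F := by
  rw [aeval_def, aeval_def, eval₂_eq, eval₂_eq, Finset.mul_sum]
  refine Finset.sum_congr rfl fun d hd => ?_
  have hdeg : ∑ i ∈ d.support, d i = n := by
    rw [← hF (mem_support_iff.mp hd), ← Finsupp.degree_apply, Finsupp.degree_eq_weight_one]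
    rfl
  simp only [mul_pow]
  rw [Finset.prod_mul_distrib, Finset.prod_pow_eq_pow_sum, hdeg]
  ring

theorem aeval_mem_subalgebra {ι K R : Type*} [CommRing K] [CommRing R] [Algebra K R]
    (S : Subalgebra K R) {v : ι → R} (hv : ∀ i, v i ∈ S) (F : MvPolynomial ι K) :
    aeval v F ∈ S := by
  have h : aeval v F ∈ (aeval (R := K) v).range := ⟨F, rfl⟩
  rw [aeval_range] at h
  exact Algebra.adjoin_le (Set.range_subset_iff.mpr hv) h

end MvPolynomial

/-- The entries of `u · [[a, c], [b, d]]`, where `u` is the `4 × 2` matrix with columns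
`(z₁, z₂, z₃, z₄)` and `(-z₂*, z₁*, -z₄*, z₃*)`, indexed and signed like the generators
`z_j`, `z_j*`. -/
def rightMul {R : Type*} [CommRing R] (z zs : Fin 4 → R) (a b c d : R) : Fin 4 ⊕ Fin 4 → R :=
  Sum.elim
    ![a * z 0 - b * zs 1, a * z 1 + b * zs 0, a * z 2 - b * zs 3, a * z 3 + b * zs 2]
    ![d * zs 0 + c * z 1, d * zs 1 - c * z 0, d * zs 2 + c * z 3, d * zs 3 - c * z 2]

theorem map_rightMul {R S : Type*} [CommRing R] [CommRing S] (f : R →+* S) (z zs : Fin 4 → R)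
    (a b c d : R) (i : Fin 4 ⊕ Fin 4) :
    f (rightMul z zs a b c d i) =
      rightMul (fun j => f (z j)) (fun j => f (zs j)) (f a) (f b) (f c) (f d) i := by
  rcases i with i | i <;> fin_cases i <;> simp [rightMul]

theorem rightMul_smul {R : Type*} [CommRing R] (t : R) (z zs : Fin 4 → R)
    (a b c d : R) (i : Fin 4 ⊕ Fin 4) :
    rightMul z zs (t * a) (t * b) (t * c) (t * d) i = t * rightMul z zs a b c d i := by
  rcases i with i | i <;> fin_cases i <;> simp [rightMul] <;> ring

/-- Every real quaternion is a real multiple of an element of `SU(2)`. -/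
theorem exists_specialUnitary_smul (r : Fin 4 → ℝ) :
    ∃ (w : Matrix.specialUnitaryGroup (Fin 2) ℂ) (t : ℝ),
      t ^ 2 = r 0 ^ 2 + r 1 ^ 2 + r 2 ^ 2 + r 3 ^ 2 ∧
      (t : ℂ) * (w : Matrix (Fin 2) (Fin 2) ℂ) 0 0 = r 0 + r 1 * Complex.I ∧
      (t : ℂ) * (w : Matrix (Fin 2) (Fin 2) ℂ) 1 0 = r 2 + r 3 * Complex.I := by
  by_cases h0 : r 0 ^ 2 + r 1 ^ 2 + r 2 ^ 2 + r 3 ^ 2 = 0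
  · have hr : ∀ i, r i = 0 := by
      rw [← Fin.sum_univ_four fun i => r i ^ 2,
        Finset.sum_eq_zero_iff_of_nonneg fun i _ => sq_nonneg (r i)] at h0
      exact fun i => pow_eq_zero_iff two_ne_zero |>.mp (h0 i (Finset.mem_univ i))
    exact ⟨1, 0, by simp [hr]⟩
  · set t := √(r 0 ^ 2 + r 1 ^ 2 + r 2 ^ 2 + r 3 ^ 2)
    have ht2 : t ^ 2 = r 0 ^ 2 + r 1 ^ 2 + r 2 ^ 2 + r 3 ^ 2 := Real.sq_sqrt (by positivity)
    have ht0 : (t : ℂ) ≠ 0 := by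
      rw [Complex.ofReal_ne_zero]
      rintro h
      rw [h] at ht2
      exact h0 (by rw [← ht2]; simp)
    have ht2' : (t : ℂ) ^ 2 = (r 0 : ℂ) ^ 2 + r 1 ^ 2 + r 2 ^ 2 + r 3 ^ 2 := by exact_mod_cast ht2
    have hI := Complex.I_sq
    let a : ℂ := (r 0 + r 1 * Complex.I) / t
    let b : ℂ := (r 2 + r 3 * Complex.I) / t
    have hab : a * starRingEnd ℂ a + b * starRingEnd ℂ b = 1 := by
      simp only [a, b, map_div₀, map_add, map_mul, Complex.conj_ofReal, Complex.conj_I]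
      field_simp
      linear_combination (-(r 1 : ℂ) ^ 2 - (r 3 : ℂ) ^ 2) * hI - ht2'
    have ha : (t : ℂ) * a = r 0 + r 1 * Complex.I := mul_div_cancel₀ _ ht0
    have hb : (t : ℂ) * b = r 2 + r 3 * Complex.I := mul_div_cancel₀ _ ht0
    clear_value a b
    refine ⟨⟨!![a, -starRingEnd ℂ b; b, starRingEnd ℂ a], ?_⟩, t, ht2, by simpa using ha, by simpa using hb⟩
    rw [Matrix.mem_specialUnitaryGroup_iff, Matrix.mem_unitaryGroup_iff]
    constructor
    · ext i j
      fin_cases i <;> fin_cases j <;>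
        simp [Matrix.mul_apply, Fin.sum_univ_two] <;> first | ring1 | linear_combination hab
    · rw [Matrix.det_fin_two_of]
      linear_combination hab

/-- A homogeneous polynomial that is invariant under `SU(2)` as a function of `u` transforms under
right multiplication by any `2 × 2` matrix through a power of the determinant. -/
theorem aeval_rightMul_eq_det_pow {R : Type*} [CommRing R] [Algebra ℂ R] (z zs : Fin 4 → R)
    {F : MvPolynomial (Fin 4 ⊕ Fin 4) ℂ} {N : ℕ} (hF : F.IsHomogeneous (2 * N)) (e : R)
    (hinv : ∀ w : Matrix.specialUnitaryGroup (Fin 2) ℂ,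
      aeval (rightMul z zs (algebraMap ℂ R ((w : Matrix (Fin 2) (Fin 2) ℂ) 0 0))
        (algebraMap ℂ R ((w : Matrix (Fin 2) (Fin 2) ℂ) 1 0))
        (algebraMap ℂ R (-starRingEnd ℂ ((w : Matrix (Fin 2) (Fin 2) ℂ) 1 0)))
        (algebraMap ℂ R (starRingEnd ℂ ((w : Matrix (Fin 2) (Fin 2) ℂ) 0 0)))) F = e)
    (a b c d : R) :
    aeval (rightMul z zs a b c d) F = (a * d - b * c) ^ N * e := by
  let J : R := algebraMap ℂ R Complex.I
  have hJ : J * J = -1 := by rw [← map_mul, Complex.I_mul_I, map_neg, map_one]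
  let H : MvPolynomial (Fin 4) R :=
    aeval (rightMul (fun j => C (z j)) (fun j => C (zs j)) (X 0 + X 1 * C J) (X 2 + X 3 * C J)
      (-(X 2 - X 3 * C J)) (X 0 - X 1 * C J)) F -
      (X 0 ^ 2 + X 1 ^ 2 + X 2 ^ 2 + X 3 ^ 2) ^ N * C e
  have hH : ∀ r : Fin 4 → R, eval r H =
      aeval (rightMul z zs (r 0 + r 1 * J) (r 2 + r 3 * J) (-(r 2 - r 3 * J)) (r 0 - r 1 * J)) F -
      (r 0 ^ 2 + r 1 ^ 2 + r 2 ^ 2 + r 3 ^ 2) ^ N * e := by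
    intro r
    let ev : MvPolynomial (Fin 4) R →ₐ[ℂ] R :=
      (aeval r : MvPolynomial (Fin 4) R →ₐ[R] R).restrictScalars ℂ
    have hev : ∀ p, eval r p = ev p := fun p => (DFunLike.congr_fun (coe_aeval_eq_eval r) p).symm
    simp only [H, map_sub, map_mul, map_pow, map_add, eval_X, eval_C]
    rw [hev, ← AlgHom.comp_apply, comp_aeval]
    congr 3
    funext i
    rw [← hev, map_rightMul]
    simp
  have hH0 : H = 0 := by
    refine eq_zero_of_eval_ofReal_eq_zero H fun r => ?_
    obtain ⟨w, t, ht, hwa, hwb⟩ := exists_specialUnitary_smul r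
    rw [hH, ← hinv w, sub_eq_zero]
    have ht' : algebraMap ℂ R (r 0) ^ 2 + algebraMap ℂ R (r 1) ^ 2 + algebraMap ℂ R (r 2) ^ 2 +
        algebraMap ℂ R (r 3) ^ 2 = algebraMap ℂ R t ^ 2 := by
      simp only [← map_pow, ← map_add]
      congr 1
      exact_mod_cast ht.symm
    rw [ht', ← pow_mul, ← hF.aeval_mul]
    have hwa' := congrArg (starRingEnd ℂ) hwa
    have hwb' := congrArg (starRingEnd ℂ) hwb
    simp only [map_mul, map_add, Complex.conj_ofReal, Complex.conj_I] at hwa' hwb'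
    congr 2
    funext i
    rw [← rightMul_smul]
    congr 1
    · rw [← map_mul, ← map_mul, ← map_add, hwa]
    · rw [← map_mul, ← map_mul, ← map_add, hwb]
    · rw [← map_mul, ← map_mul, ← map_sub, ← map_neg, mul_neg, hwb']
      ring_nf
    · rw [← map_mul, ← map_mul, ← map_sub, hwa']
      ring_nf
  let h : R := algebraMap ℂ R (1 / 2)
  have hh : 2 * h = 1 := by
    rw [← map_ofNat (algebraMap ℂ R) 2, ← map_mul]
    norm_num
  have key := hH ![h * (a + d), -h * J * (a - d), h * (b - c), -h * J * (b + c)]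
  rw [hH0, map_zero, eq_comm, sub_eq_zero] at key
  simp only [Matrix.cons_val] at key
  have ea : h * (a + d) + -h * J * (a - d) * J = a := by
    linear_combination -h * (a - d) * hJ + a * hh
  have eb : h * (b - c) + -h * J * (b + c) * J = b := by
    linear_combination -h * (b + c) * hJ + b * hh
  have ec : -(h * (b - c) - -h * J * (b + c) * J) = c := by
    linear_combination -h * (b + c) * hJ + c * hh
  have ed : h * (a + d) - -h * J * (a - d) * J = d := by
    linear_combination h * (a - d) * hJ + d * hh
  have edet : (h * (a + d)) ^ 2 + (-h * J * (a - d)) ^ 2 + (h * (b - c)) ^ 2 +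
      (-h * J * (b + c)) ^ 2 = a * d - b * c := by
    linear_combination h ^ 2 * ((a - d) ^ 2 + (b + c) ^ 2) * hJ +
      (a * d - b * c) * (2 * h + 1) * hh
  rwa [ea, eb, ec, ed, edet] at key

namespace SevenSphere

/-- The quotient map from the polynomial algebra. -/
def proj : MvPolynomial (Fin 4 ⊕ Fin 4) ℂ →ₐ[ℂ] SevenSphere :=
  Ideal.Quotient.mkₐ ℂ (Ideal.span {spherePoly})

theorem aeval_generators : aeval (Sum.elim zg zgs) = proj := by
  ext i
  rcases i with i | i <;> rw [aeval_X] <;> rfl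

theorem sphere_relation :
    zgs 0 * zg 0 + zgs 1 * zg 1 + zgs 2 * zg 2 + zgs 3 * zg 3 = 1 := by
  have h : aeval (Sum.elim zg zgs) spherePoly = 0 := by
    rw [aeval_generators]
    exact Ideal.Quotient.eq_zero_iff_mem.mpr (Ideal.mem_span_singleton_self _)
  simpa [spherePoly, Fin.sum_univ_four, sub_eq_zero] using h

/-- An element fixed by the antipodal map is represented by a homogeneous polynomial of even
degree. -/
theorem exists_isHomogeneous_of_antipode {a : SevenSphere} (τ : SevenSphere →ₐ[ℂ] SevenSphere)
    (hz : ∀ j, τ (zg j) = -zg j) (hzs : ∀ j, τ (zgs j) = -zgs j) (ha : τ a = a) :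
    ∃ (N : ℕ) (F : MvPolynomial (Fin 4 ⊕ Fin 4) ℂ), F.IsHomogeneous (2 * N) ∧
      aeval (Sum.elim zg zgs) F = a := by
  obtain ⟨G, hG⟩ := Ideal.Quotient.mk_surjective (I := Ideal.span {spherePoly}) a
  have hGa : aeval (Sum.elim zg zgs) G = a := (DFunLike.congr_fun aeval_generators G).trans hG
  let comp (k : ℕ) : SevenSphere := aeval (Sum.elim zg zgs) (homogeneousComponent k G)
  let n := G.totalDegree + 1
  have hsum : a = ∑ k ∈ Finset.range n, comp k := by
    rw [← hGa, ← map_sum, sum_homogeneousComponent]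
  have hτ : ∀ k, τ (comp k) = (-1) ^ k * comp k := by
    intro k
    rw [← (homogeneousComponent_isHomogeneous k G).aeval_mul, ← AlgHom.comp_apply, comp_aeval]
    congr 2
    funext i
    rcases i with i | i <;> simp [hz, hzs]
  have hτsum : a = ∑ k ∈ Finset.range n, (-1) ^ k * comp k := by
    rw [← ha, hsum, map_sum]
    exact Finset.sum_congr rfl fun k _ => hτ k
  have heven : a = ∑ k ∈ Finset.range n with Even k, comp k := by
    have h2 : (2 : ℂ) • a = (2 : ℂ) • ∑ k ∈ Finset.range n with Even k, comp k := by
      rw [two_smul, two_smul]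
      nth_rw 1 [hsum]
      rw [hτsum, ← Finset.sum_add_distrib, Finset.sum_filter, ← Finset.sum_add_distrib]
      refine Finset.sum_congr rfl fun k _ => ?_
      rcases Nat.even_or_odd k with hk | hk
      · simp [hk]
      · simp [hk.neg_one_pow, Nat.not_even_iff_odd.mpr hk]
    exact smul_right_injective _ (two_ne_zero : (2 : ℂ) ≠ 0) h2
  let q : MvPolynomial (Fin 4 ⊕ Fin 4) ℂ := ∑ j : Fin 4, X (Sum.inr j) * X (Sum.inl j)
  have hq : q.IsHomogeneous 2 :=
    IsHomogeneous.sum _ _ _ fun j _ => (isHomogeneous_X _ _).mul (isHomogeneous_X _ _)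
  have hq1 : aeval (Sum.elim zg zgs) q = 1 := by
    simpa [q, Fin.sum_univ_four] using sphere_relation
  refine ⟨n, ∑ k ∈ Finset.range n with Even k, homogeneousComponent k G * q ^ (n - k / 2),
    IsHomogeneous.sum _ _ _ fun k hk => ?_, ?_⟩
  · rw [Finset.mem_filter, Finset.mem_range] at hk
    obtain ⟨hkn, m, rfl⟩ := hk
    convert (homogeneousComponent_isHomogeneous (m + m) G).mul (hq.pow (n - (m + m) / 2)) using 1
    omega
  · rw [heven, map_sum]
    exact Finset.sum_congr rfl fun k _ => by rw [map_mul, map_pow, hq1, one_pow, mul_one]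

end SevenSphere

/-- Let `SU(2)` act on `A(S⁷)` by `ℂ`-algebra automorphisms determined on
generators by `u ↦ u·w`, i.e. for `w = [[a, −ā'],[b, ā]]` (with `a = w₀₀`, `b = w₁₀`):
`z₁ ↦ a z₁ − b z₂*`, `z₂ ↦ a z₂ + b z₁*`, `z₃ ↦ a z₃ − b z₄*`, `z₄ ↦ a z₄ + b z₃*`,
and correspondingly (conjugately) on the `z_j*`. Then the subalgebra of `SU(2)`-invariant
elements of `A(S⁷)` equals the `ℂ`-subalgebra generated by
`α := 2(z₁z₃* + z₂*z₄)`, `β := 2(z₂z₃* − z₁*z₄)`,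
`x := z₁z₁* + z₂z₂* − z₃z₃* − z₄z₄*`, together with `α*` and `β*`. -/
theorem stmt4
    (σ : Matrix.specialUnitaryGroup (Fin 2) ℂ → (SevenSphere ≃ₐ[ℂ] SevenSphere))
    (h1 : ∀ w : Matrix.specialUnitaryGroup (Fin 2) ℂ,
      σ w (zg 0) = (w : Matrix (Fin 2) (Fin 2) ℂ) 0 0 • zg 0
        - (w : Matrix (Fin 2) (Fin 2) ℂ) 1 0 • zgs 1)
    (h2 : ∀ w : Matrix.specialUnitaryGroup (Fin 2) ℂ,
      σ w (zg 1) = (w : Matrix (Fin 2) (Fin 2) ℂ) 0 0 • zg 1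
        + (w : Matrix (Fin 2) (Fin 2) ℂ) 1 0 • zgs 0)
    (h3 : ∀ w : Matrix.specialUnitaryGroup (Fin 2) ℂ,
      σ w (zg 2) = (w : Matrix (Fin 2) (Fin 2) ℂ) 0 0 • zg 2
        - (w : Matrix (Fin 2) (Fin 2) ℂ) 1 0 • zgs 3)
    (h4 : ∀ w : Matrix.specialUnitaryGroup (Fin 2) ℂ,
      σ w (zg 3) = (w : Matrix (Fin 2) (Fin 2) ℂ) 0 0 • zg 3
        + (w : Matrix (Fin 2) (Fin 2) ℂ) 1 0 • zgs 2)
    (h1s : ∀ w : Matrix.specialUnitaryGroup (Fin 2) ℂ,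
      σ w (zgs 0) = starRingEnd ℂ ((w : Matrix (Fin 2) (Fin 2) ℂ) 0 0) • zgs 0
        - starRingEnd ℂ ((w : Matrix (Fin 2) (Fin 2) ℂ) 1 0) • zg 1)
    (h2s : ∀ w : Matrix.specialUnitaryGroup (Fin 2) ℂ,
      σ w (zgs 1) = starRingEnd ℂ ((w : Matrix (Fin 2) (Fin 2) ℂ) 0 0) • zgs 1
        + starRingEnd ℂ ((w : Matrix (Fin 2) (Fin 2) ℂ) 1 0) • zg 0)
    (h3s : ∀ w : Matrix.specialUnitaryGroup (Fin 2) ℂ,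
      σ w (zgs 2) = starRingEnd ℂ ((w : Matrix (Fin 2) (Fin 2) ℂ) 0 0) • zgs 2
        - starRingEnd ℂ ((w : Matrix (Fin 2) (Fin 2) ℂ) 1 0) • zg 3)
    (h4s : ∀ w : Matrix.specialUnitaryGroup (Fin 2) ℂ,
      σ w (zgs 3) = starRingEnd ℂ ((w : Matrix (Fin 2) (Fin 2) ℂ) 0 0) • zgs 3
        + starRingEnd ℂ ((w : Matrix (Fin 2) (Fin 2) ℂ) 1 0) • zg 2) :
    ∀ a : SevenSphere, (∀ w : Matrix.specialUnitaryGroup (Fin 2) ℂ, σ w a = a) ↔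
      a ∈ Algebra.adjoin ℂ
        ({2 * (zg 0 * zgs 2 + zgs 1 * zg 3),
          2 * (zg 1 * zgs 2 - zgs 0 * zg 3),
          zg 0 * zgs 0 + zg 1 * zgs 1 - zg 2 * zgs 2 - zg 3 * zgs 3,
          2 * (zgs 0 * zg 2 + zg 1 * zgs 3),
          2 * (zgs 1 * zg 2 - zg 0 * zgs 3)} : Set SevenSphere) := by
  intro a
  set B := Algebra.adjoin ℂ (_ : Set SevenSphere)
  constructor
  · intro ha
    let w₀ : Matrix.specialUnitaryGroup (Fin 2) ℂ :=
      ⟨-1, by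
        rw [Matrix.mem_specialUnitaryGroup_iff, Matrix.mem_unitaryGroup_iff]
        simp [Matrix.det_neg]⟩
    have hw00 : (w₀ : Matrix (Fin 2) (Fin 2) ℂ) 0 0 = -1 := by simp [w₀]
    have hw10 : (w₀ : Matrix (Fin 2) (Fin 2) ℂ) 1 0 = 0 := by simp [w₀]
    obtain ⟨N, F, hF, hFa⟩ := SevenSphere.exists_isHomogeneous_of_antipode
      (σ w₀ : SevenSphere →ₐ[ℂ] SevenSphere)
      (fun j => by fin_cases j <;> simp [h1, h2, h3, h4, hw00, hw10, Algebra.smul_def])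
      (fun j => by fin_cases j <;> simp [h1s, h2s, h3s, h4s, hw00, hw10, Algebra.smul_def]) (ha w₀)
    have hdet := aeval_rightMul_eq_det_pow zg zgs hF a fun w => by
      rw [← ha w, ← hFa, ← AlgEquiv.coe_toAlgHom, ← AlgHom.comp_apply, comp_aeval]
      congr 2
      funext i
      rcases i with i | i <;> fin_cases i <;>
        simp [rightMul, h1, h2, h3, h4, h1s, h2s, h3s, h4s, Algebra.smul_def, sub_eq_add_neg]
    have half : ∀ y : SevenSphere, 2 * y ∈ B → y ∈ B := fun y hy => by
      have := B.smul_mem hy (1 / 2 : ℂ)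
      rwa [two_mul, ← two_smul ℂ y, smul_smul, one_div, inv_mul_cancel₀ two_ne_zero, one_smul] at this
    have hα := half _ (Algebra.subset_adjoin (by simp) : 2 * (zg 0 * zgs 2 + zgs 1 * zg 3) ∈ B)
    have hβ := half _ (Algebra.subset_adjoin (by simp) : 2 * (zg 1 * zgs 2 - zgs 0 * zg 3) ∈ B)
    have hαs := half _ (Algebra.subset_adjoin (by simp) : 2 * (zgs 0 * zg 2 + zg 1 * zgs 3) ∈ B)
    have hβs := half _ (Algebra.subset_adjoin (by simp) : 2 * (zgs 1 * zg 2 - zg 0 * zgs 3) ∈ B)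
    have hx : zg 0 * zgs 0 + zg 1 * zgs 1 - zg 2 * zgs 2 - zg 3 * zgs 3 ∈ B :=
      Algebra.subset_adjoin (by simp)
    have hrel := SevenSphere.sphere_relation
    have hp : zgs 0 * zg 0 + zg 1 * zgs 1 ∈ B := half _ <| by
      convert B.add_mem B.one_mem hx using 1
      linear_combination hrel
    have hq : zgs 2 * zg 2 + zg 3 * zgs 3 ∈ B := half _ <| by
      convert B.sub_mem B.one_mem hx using 1
      linear_combination hrel
    have hpa : (zgs 0 * zg 0 + zg 1 * zgs 1) ^ N * a ∈ B := by
      have h := hdet (zgs 0) (-zg 1) (zgs 1) (zg 0)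
      rw [show zgs 0 * zg 0 - -zg 1 * zgs 1 = zgs 0 * zg 0 + zg 1 * zgs 1 by ring] at h
      rw [← h]
      refine aeval_mem_subalgebra B (fun i => ?_) F
      rcases i with i | i <;> fin_cases i <;> simp only [rightMul] <;> dsimp
      · convert hp using 1; ring
      · convert B.zero_mem using 1; ring
      · convert hαs using 1; ring
      · convert B.neg_mem hβ using 1; ring
      · convert hp using 1; ring
      · convert B.zero_mem using 1; ring
      · exact hα
      · convert B.neg_mem hβs using 1; ring
    have hqa : (zgs 2 * zg 2 + zg 3 * zgs 3) ^ N * a ∈ B := by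
      have h := hdet (zgs 2) (-zg 3) (zgs 3) (zg 2)
      rw [show zgs 2 * zg 2 - -zg 3 * zgs 3 = zgs 2 * zg 2 + zg 3 * zgs 3 by ring] at h
      rw [← h]
      refine aeval_mem_subalgebra B (fun i => ?_) F
      rcases i with i | i <;> fin_cases i <;> simp only [rightMul] <;> dsimp
      · convert hα using 1; ring
      · convert hβ using 1; ring
      · convert hq using 1; ring
      · convert B.zero_mem using 1; ring
      · convert hαs using 1; ring
      · convert hβs using 1; ring
      · convert hq using 1; ring
      · convert B.zero_mem using 1; ring
    have hcop : IsCoprime ((⟨_, hp⟩ : B) ^ N) ((⟨_, hq⟩ : B) ^ N) :=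
      IsCoprime.pow ⟨1, 1, Subtype.ext <| by
        simp only [one_mul]
        change (_ + _ : SevenSphere) = 1
        linear_combination hrel⟩
    obtain ⟨s, t, hst⟩ := hcop
    have hst' := congrArg (Subtype.val : B → SevenSphere) hst
    change (s : SevenSphere) * (_ : SevenSphere) ^ N + (t : SevenSphere) * (_ : SevenSphere) ^ N = 1
      at hst'
    convert B.add_mem (B.mul_mem s.2 hpa) (B.mul_mem t.2 hqa) using 1
    linear_combination -a * hst'
  · intro ha w
    have hw : (w : Matrix (Fin 2) (Fin 2) ℂ) 0 0 *
        starRingEnd ℂ ((w : Matrix (Fin 2) (Fin 2) ℂ) 0 0)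
        + (w : Matrix (Fin 2) (Fin 2) ℂ) 1 0 * starRingEnd ℂ ((w : Matrix (Fin 2) (Fin 2) ℂ) 1 0)
        = 1 := by
      have h := Matrix.mem_unitaryGroup_iff'.mp (Matrix.mem_specialUnitaryGroup_iff.mp w.2).1
      have h00 := congrFun (congrFun h 0) 0
      simp [Matrix.mul_apply, Fin.sum_univ_two] at h00
      linear_combination h00
    have hw' := congrArg (algebraMap ℂ SevenSphere) hw
    simp only [map_add, map_mul, map_one] at hw'
    have hle : B ≤ AlgHom.equalizer (σ w : SevenSphere →ₐ[ℂ] SevenSphere) (AlgHom.id ℂ _) := by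
      refine Algebra.adjoin_le ?_
      rintro y (rfl | rfl | rfl | rfl | rfl)
      all_goals
        change σ w _ = _
        simp only [map_add, map_sub, map_mul, map_ofNat, h1, h2, h3, h4, h1s, h2s, h3s, h4s,
          Algebra.smul_def, AlgHom.id_apply]
      · linear_combination 2 * (zg 0 * zgs 2 + zgs 1 * zg 3) * hw'
      · linear_combination 2 * (zg 1 * zgs 2 - zgs 0 * zg 3) * hw'
      · linear_combination
          (zg 0 * zgs 0 + zg 1 * zgs 1 - zg 2 * zgs 2 - zg 3 * zgs 3) * hw'
      · linear_combination 2 * (zgs 0 * zg 2 + zg 1 * zgs 3) * hw'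
      · linear_combination 2 * (zgs 1 * zg 2 - zg 0 * zgs 3) * hw'
    exact hle ha
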